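/- Let f : ℝ^D × ℝ^K → ℝ^D, r : ℝ^D × ℝ^K → ℝ, and r_T : ℝ^D → ℝ be differentiable, fix x_0 ∈ ℝ^D and T ≥ 1, and for u = (u_0,…,u_{T−1}) ∈ (ℝ^K)^T define states x_0(u) := x_0, x_{t+1}(u) := f(x_t(u), u_t), and the objective J(u) := ∑_{t=0}^{T−1} r(x_t(u), u_t) + r_T(x_T(u)). Fix u and write x_t := x_t(u); define costates by λ_T := ∇r_T(x_T) and λ_t := ∇_x r(x_t, u_t) + ∇_x f(x_t, u_t)·λ_{t+1}. Then J is differentiable at u and, for every t ∈ {0,…,T−1}, the partial gradient of J with respect to the t-th action block satisfies ∇_{u_t} J(u) = ∇_u r(x_t, u_t) + ∇_u f(x_t, u_t)·λ_{t+1}. -/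

import Mathlib

open InnerProductSpace Matrix

/-- The linear map `x ↦ Aᵀᵀ…`, i.e. `x ↦ A.mulVec x`, as a continuous linear map between
Euclidean spaces. -/
noncomputable def mulVecCLM {m n : ℕ} (A : Matrix (Fin m) (Fin n) ℝ) :
    EuclideanSpace ℝ (Fin n) →L[ℝ] EuclideanSpace ℝ (Fin m) :=
  LinearMap.toContinuousLinearMap (Matrix.toEuclideanLin A)

/-- Matrix-vector multiplication between Euclidean spaces. -/
noncomputable def mulVecE {m n : ℕ} (A : Matrix (Fin m) (Fin n) ℝ)
    (x : EuclideanSpace ℝ (Fin n)) : EuclideanSpace ℝ (Fin m) :=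
  mulVecCLM A x

/-- Largest singular value `σ̄(A)`: the operator norm of `A`. -/
noncomputable def smax {m n : ℕ} (A : Matrix (Fin m) (Fin n) ℝ) : ℝ :=
  ‖mulVecCLM A‖

/-- Smallest singular value `σ̲(A) = inf_{‖x‖ = 1} ‖Ax‖`. -/
noncomputable def smin {m n : ℕ} (A : Matrix (Fin m) (Fin n) ℝ) : ℝ :=
  ⨅ x : {x : EuclideanSpace ℝ (Fin n) // ‖x‖ = 1}, ‖mulVecE A (x : EuclideanSpace ℝ (Fin n))‖

/-- The partial (block) gradient `∇_{u_t} J(u)` of a function on a product of Euclidean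
spaces: the gradient of `v ↦ J(u with t-th block replaced by v)` at `u t`. -/
noncomputable def gradBlock {K T : ℕ}
    (J : PiLp 2 (fun _ : Fin T => EuclideanSpace ℝ (Fin K)) → ℝ)
    (u : PiLp 2 (fun _ : Fin T => EuclideanSpace ℝ (Fin K))) (t : Fin T) :
    EuclideanSpace ℝ (Fin K) :=
  gradient (fun v => J ((WithLp.equiv 2 _).symm
    (Function.update ((WithLp.equiv 2 _) u) t v))) (u t)

/-- A joint Fréchet derivative on a product is the coproduct of the partial derivatives. -/
theorem hasFDerivAt_coprod_of_partial {E F G : Type*} [NormedAddCommGroup E] [NormedSpace ℝ E]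
    [NormedAddCommGroup F] [NormedSpace ℝ F] [NormedAddCommGroup G] [NormedSpace ℝ G]
    {g : E → F → G} {x : E} {y : F} {gx : E →L[ℝ] G} {gy : F →L[ℝ] G}
    (hg : DifferentiableAt ℝ (fun p : E × F => g p.1 p.2) (x, y))
    (hx : HasFDerivAt (fun z => g z y) gx x) (hy : HasFDerivAt (fun w => g x w) gy y) :
    HasFDerivAt (fun p : E × F => g p.1 p.2) (gx.coprod gy) (x, y) := by
  have h := hg.hasFDerivAt
  have h1 := (h.comp (f := fun z => (z, y)) x (hasFDerivAt_prodMk_left x y)).unique hx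
  have h2 := (h.comp (f := fun w => (x, w)) y (hasFDerivAt_prodMk_right x y)).unique hy
  convert h using 1
  rw [← h1, ← h2]
  ext v <;> simp

/-- Multiplication by `Aᵀ` is adjoint to multiplication by `A`. -/
theorem inner_mulVecCLM_transpose {m n : ℕ} (A : Matrix (Fin m) (Fin n) ℝ)
    (x : EuclideanSpace ℝ (Fin n)) (y : EuclideanSpace ℝ (Fin m)) :
    inner ℝ x (mulVecCLM Aᵀ y) = inner ℝ (mulVecE A x) y := by
  have h := (Matrix.toEuclideanLin A).adjoint_inner_right x y
  rw [← Matrix.toEuclideanLin_conjTranspose_eq_adjoint,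
    Matrix.conjTranspose_eq_transpose_of_trivial] at h
  exact h

/-- The block gradient is the corresponding component of the full gradient. -/
theorem gradBlock_eq_of_hasGradientAt {K T : ℕ}
    {J : PiLp 2 (fun _ : Fin T => EuclideanSpace ℝ (Fin K)) → ℝ}
    {G u : PiLp 2 (fun _ : Fin T => EuclideanSpace ℝ (Fin K))}
    (hJ : HasGradientAt J G u) (t : Fin T) : gradBlock J u t = G t := by
  refine HasGradientAt.gradient (hasGradientAt_iff_hasFDerivAt.2 ?_)
  have hupd := ((PiLp.continuousLinearEquiv 2 ℝ
    (fun _ : Fin T => EuclideanSpace ℝ (Fin K))).symm.hasFDerivAt).comp (u t)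
      (hasFDerivAt_update (𝕜 := ℝ) (WithLp.ofLp u) (i := t) (u t))
  have hJ' : HasFDerivAt J (toDual ℝ _ G)
      (((PiLp.continuousLinearEquiv 2 ℝ (fun _ : Fin T => EuclideanSpace ℝ (Fin K))).symm ∘
        Function.update (WithLp.ofLp u) t) (u t)) := by
    simpa using hJ.hasFDerivAt
  refine (hJ'.comp (u t) hupd).congr_fderiv ?_
  ext1 v
  simp only [ContinuousLinearMap.comp_apply, toDual_apply_apply, PiLp.inner_apply]
  rw [Finset.sum_eq_single t] <;> simp +contextual [Pi.single_apply]

/-- Adjoint form of the chain rule: when the actions `U t` depend differentiably on a parameter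
`v`, the costates eliminate the derivatives of the states from the derivative of the objective. -/
theorem hasFDerivAt_objective_of_costate {V : Type*} [NormedAddCommGroup V] [NormedSpace ℝ V]
    {D K T : ℕ}
    {f : EuclideanSpace ℝ (Fin D) → EuclideanSpace ℝ (Fin K) → EuclideanSpace ℝ (Fin D)}
    {r : EuclideanSpace ℝ (Fin D) → EuclideanSpace ℝ (Fin K) → ℝ}
    {rT : EuclideanSpace ℝ (Fin D) → ℝ} {x0 : EuclideanSpace ℝ (Fin D)}
    {Dxf : EuclideanSpace ℝ (Fin D) → EuclideanSpace ℝ (Fin K) → Matrix (Fin D) (Fin D) ℝ}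
    {Duf : EuclideanSpace ℝ (Fin D) → EuclideanSpace ℝ (Fin K) → Matrix (Fin K) (Fin D) ℝ}
    {Dxr : EuclideanSpace ℝ (Fin D) → EuclideanSpace ℝ (Fin K) → EuclideanSpace ℝ (Fin D)}
    {Dur : EuclideanSpace ℝ (Fin D) → EuclideanSpace ℝ (Fin K) → EuclideanSpace ℝ (Fin K)}
    (hf : Differentiable ℝ (fun p : EuclideanSpace ℝ (Fin D) × EuclideanSpace ℝ (Fin K) =>
      f p.1 p.2))
    (hr : Differentiable ℝ (fun p : EuclideanSpace ℝ (Fin D) × EuclideanSpace ℝ (Fin K) =>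
      r p.1 p.2))
    (hrT : Differentiable ℝ rT)
    (hDxf : ∀ x u', HasFDerivAt (fun y => f y u') (mulVecCLM (Dxf x u')ᵀ) x)
    (hDuf : ∀ x u', HasFDerivAt (fun w => f x w) (mulVecCLM (Duf x u')ᵀ) u')
    (hDxr : ∀ x u', HasGradientAt (fun y => r y u') (Dxr x u') x)
    (hDur : ∀ x u', HasGradientAt (fun w => r x w) (Dur x u') u')
    {X : V → ℕ → EuclideanSpace ℝ (Fin D)} {U : V → Fin T → EuclideanSpace ℝ (Fin K)}
    {U' : Fin T → V →L[ℝ] EuclideanSpace ℝ (Fin K)} {v : V}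
    (hU : ∀ t, HasFDerivAt (fun w => U w t) (U' t) v)
    (hX0 : ∀ w, X w 0 = x0) (hX : ∀ w (t : Fin T), X w ((t : ℕ) + 1) = f (X w t) (U w t))
    {lam : ℕ → EuclideanSpace ℝ (Fin D)} (hlamT : lam T = gradient rT (X v T))
    (hlam : ∀ t : Fin T, lam t =
      Dxr (X v t) (U v t) + mulVecE (Dxf (X v t) (U v t)) (lam ((t : ℕ) + 1))) :
    HasFDerivAt (fun w => (∑ t : Fin T, r (X w t) (U w t)) + rT (X w T))
      (∑ t : Fin T, (toDual ℝ _ (Dur (X v t) (U v t) +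
        mulVecE (Duf (X v t) (U v t)) (lam ((t : ℕ) + 1)))).comp (U' t)) v := by
  have hstep (t : Fin T) {Y : V →L[ℝ] EuclideanSpace ℝ (Fin D)}
      (hY : HasFDerivAt (fun w => X w t) Y v) :
      HasFDerivAt (fun w => X w ((t : ℕ) + 1))
        (((mulVecCLM (Dxf (X v t) (U v t))ᵀ).coprod (mulVecCLM (Duf (X v t) (U v t))ᵀ)).comp
          (Y.prod (U' t))) v := by
    simp only [hX]
    exact (hasFDerivAt_coprod_of_partial (hf _) (hDxf _ _) (hDuf _ _)).comp
      (f := fun w => (X w t, U w t)) v (hY.prodMk (hU t))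
  have hdiff (n : ℕ) (hn : n ≤ T) : DifferentiableAt ℝ (fun w => X w n) v := by
    induction n with
    | zero => simp [hX0]
    | succ n ih => exact (hstep ⟨n, hn⟩ (ih (by omega)).hasFDerivAt).differentiableAt
  have hreward (t : Fin T) := (hasFDerivAt_coprod_of_partial (hr _)
    (hDxr (X v t) (U v t)).hasFDerivAt (hDur (X v t) (U v t)).hasFDerivAt).comp
      (f := fun w => (X w t, U w t)) v ((hdiff t t.2.le).hasFDerivAt.prodMk (hU t))
  have hterm := ((hrT (X v T)).hasGradientAt.hasFDerivAt).comp v (hdiff T le_rfl).hasFDerivAt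
  refine ((HasFDerivAt.fun_sum fun t _ => hreward t).add hterm).congr_fderiv ?_
  ext1 h
  let c (n : ℕ) : ℝ := inner ℝ (lam n) (fderiv ℝ (fun w => X w n) v h)
  have hc0 : c 0 = 0 := by simp [c, hX0]
  have hc (t : Fin T) : inner ℝ (Dxr (X v t) (U v t)) (fderiv ℝ (fun w => X w t) v h) =
      inner ℝ (mulVecE (Duf (X v t) (U v t)) (lam ((t : ℕ) + 1))) (U' t h)
        - (c (t + 1) - c t) := by
    have hY := (hstep t (hdiff t t.2.le).hasFDerivAt).fderiv
    simp only [c, hY, hlam t]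
    simp [inner_add_left, inner_add_right, inner_mulVecCLM_transpose]
    ring
  have htel : ∑ t : Fin T, (c (t + 1) - c t) = c T := by
    rw [Fin.sum_univ_eq_sum_range (fun n => c (n + 1) - c n), Finset.sum_range_sub, hc0, sub_zero]
  have hcT : inner ℝ (gradient rT (X v T)) (fderiv ℝ (fun w => X w T) v h) = c T := by
    rw [← hlamT]
  clear_value c
  simp only [_root_.add_apply, _root_.sum_apply,
    ContinuousLinearMap.comp_apply, ContinuousLinearMap.coprod_apply,
    ContinuousLinearMap.prod_apply, toDual_apply_apply, hc, hcT, ← htel, inner_add_left]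
  rw [← Finset.sum_add_distrib]
  exact Finset.sum_congr rfl fun t _ => by ring

/-- Pontryagin's stationarity identity: the objective
`J(u) = ∑_{t<T} r(x_t(u), u_t) + r_T(x_T(u))` is differentiable, and its partial gradient
with respect to the `t`-th action block is
`∇_{u_t} J(u) = ∇_u r(x_t, u_t) + ∇_u f(x_t, u_t)·λ_{t+1}`, where the costates satisfy
`λ_T = ∇r_T(x_T)` and `λ_t = ∇_x r(x_t,u_t) + ∇_x f(x_t,u_t)·λ_{t+1}`. -/
theorem stmt_10 {D K : ℕ} (T : ℕ) (hT : 1 ≤ T)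
    (f : EuclideanSpace ℝ (Fin D) → EuclideanSpace ℝ (Fin K) → EuclideanSpace ℝ (Fin D))
    (r : EuclideanSpace ℝ (Fin D) → EuclideanSpace ℝ (Fin K) → ℝ)
    (rT : EuclideanSpace ℝ (Fin D) → ℝ)
    (x0 : EuclideanSpace ℝ (Fin D))
    -- transposed Jacobians of f and partial gradients of r
    (Dxf : EuclideanSpace ℝ (Fin D) → EuclideanSpace ℝ (Fin K) → Matrix (Fin D) (Fin D) ℝ)
    (Duf : EuclideanSpace ℝ (Fin D) → EuclideanSpace ℝ (Fin K) → Matrix (Fin K) (Fin D) ℝ)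
    (Dxr : EuclideanSpace ℝ (Fin D) → EuclideanSpace ℝ (Fin K) → EuclideanSpace ℝ (Fin D))
    (Dur : EuclideanSpace ℝ (Fin D) → EuclideanSpace ℝ (Fin K) → EuclideanSpace ℝ (Fin K))
    (hf : Differentiable ℝ (fun p : EuclideanSpace ℝ (Fin D) × EuclideanSpace ℝ (Fin K) =>
      f p.1 p.2))
    (hr : Differentiable ℝ (fun p : EuclideanSpace ℝ (Fin D) × EuclideanSpace ℝ (Fin K) =>
      r p.1 p.2))
    (hrT : Differentiable ℝ rT)
    (hDxf : ∀ x u', HasFDerivAt (fun y => f y u') (mulVecCLM (Dxf x u')ᵀ) x)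
    (hDuf : ∀ x u', HasFDerivAt (fun w => f x w) (mulVecCLM (Duf x u')ᵀ) u')
    (hDxr : ∀ x u', HasGradientAt (fun y => r y u') (Dxr x u') x)
    (hDur : ∀ x u', HasGradientAt (fun w => r x w) (Dur x u') u')
    -- states as a function of the action sequence
    (xtraj : PiLp 2 (fun _ : Fin T => EuclideanSpace ℝ (Fin K)) → ℕ →
      EuclideanSpace ℝ (Fin D))
    (hx0 : ∀ u, xtraj u 0 = x0)
    (hxrec : ∀ u (t : Fin T), xtraj u ((t : ℕ) + 1) = f (xtraj u t) (u t))
    -- the objective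
    (J : PiLp 2 (fun _ : Fin T => EuclideanSpace ℝ (Fin K)) → ℝ)
    (hJ : ∀ u, J u = (∑ t : Fin T, r (xtraj u t) (u t)) + rT (xtraj u T))
    -- a fixed action sequence and its costates
    (u : PiLp 2 (fun _ : Fin T => EuclideanSpace ℝ (Fin K)))
    (lam : ℕ → EuclideanSpace ℝ (Fin D))
    (hlamT : lam T = gradient rT (xtraj u T))
    (hlam : ∀ t : Fin T, lam t =
      Dxr (xtraj u t) (u t) + mulVecE (Dxf (xtraj u t) (u t)) (lam ((t : ℕ) + 1))) :
    DifferentiableAt ℝ J u ∧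
      ∀ t : Fin T, gradBlock J u t =
        Dur (xtraj u t) (u t) + mulVecE (Duf (xtraj u t) (u t)) (lam ((t : ℕ) + 1)) := by
  have hgrad : HasGradientAt J (WithLp.toLp 2 fun t : Fin T =>
      Dur (xtraj u t) (u t) + mulVecE (Duf (xtraj u t) (u t)) (lam ((t : ℕ) + 1))) u := by
    rw [hasGradientAt_iff_hasFDerivAt, funext hJ]
    refine (hasFDerivAt_objective_of_costate hf hr hrT hDxf hDuf hDxr hDur
      (U := fun w t => w t)
      (fun t => (PiLp.proj 2 (fun _ : Fin T => EuclideanSpace ℝ (Fin K)) t :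
        _ →L[ℝ] _).hasFDerivAt) hx0 hxrec hlamT hlam).congr_fderiv ?_
    ext1 h
    simp only [_root_.sum_apply, ContinuousLinearMap.comp_apply, toDual_apply_apply,
      PiLp.inner_apply (𝕜 := ℝ) (f := fun _ : Fin T => EuclideanSpace ℝ (Fin K))]
    rfl
  exact ⟨hgrad.differentiableAt, gradBlock_eq_of_hasGradientAt hgrad⟩
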